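/- In ℤ_p[x], the ideal generated by x^{p^t} − 1 together with the elements (x^m − 1)² for m = 1, …, p^t equals the ideal generated by p^t·(x − 1) and (x − 1)². Consequently, the quotient ring ℤ_p[x]/(x^{p^t} − 1, (x − 1)²) is isomorphic, via x ↦ 1 + X, to ℤ_p[X]/(X², p^t·X). -/

import Mathlib

open Polynomial

/-- `x ^ n - 1` agrees with its linear Taylor expansion at `1` modulo `(x - 1) ^ 2`. -/
theorem sub_one_sq_dvd_pow_sub_one_sub {R : Type*} [CommRing R] (x : R) (n : ℕ) :
    (x - 1) ^ 2 ∣ x ^ n - 1 - n * (x - 1) := by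
  induction n with
  | zero => simp
  | succ n ih =>
    obtain ⟨c, hc⟩ := ih
    exact ⟨x * c + n, by push_cast; linear_combination x * hc⟩

theorem Ideal.span_pow_sub_one_sub_one_sq {R : Type*} [CommRing R] (x : R) (n : ℕ) :
    Ideal.span {x ^ n - 1, (x - 1) ^ 2} = Ideal.span {n * (x - 1), (x - 1) ^ 2} := by
  obtain ⟨c, hc⟩ := sub_one_sq_dvd_pow_sub_one_sub x n
  rw [show x ^ n - 1 = n * (x - 1) + (x - 1) ^ 2 * c by linear_combination hc,
    Ideal.span_pair_add_right_mul]

theorem Ideal.span_insert_pow_sub_one_sq {R : Type*} [CommRing R] (x a : R) {n : ℕ}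
    (hn : 1 ≤ n) :
    Ideal.span (insert a ((fun m : ℕ => (x ^ m - 1) ^ 2) '' Set.Icc 1 n)) =
      Ideal.span {a, (x - 1) ^ 2} := by
  rw [Ideal.span_insert, Ideal.span_insert]
  congr 1
  apply le_antisymm
  · rw [Ideal.span_le]
    rintro _ ⟨m, -, rfl⟩
    exact Ideal.mem_span_singleton.2 (pow_dvd_pow_of_dvd (sub_one_dvd_pow_sub_one x m) 2)
  · rw [Ideal.span_singleton_le_iff_mem]
    exact Ideal.subset_span ⟨1, ⟨le_rfl, hn⟩, by simp⟩

/-- In `ℤ_p[x]`, the ideal generated by `x^{p^t} − 1` together with the elements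
`(x^m − 1)²` for `m = 1, …, p^t` equals the ideal generated by `p^t·(x − 1)` and
`(x − 1)²`.  Consequently, the quotient ring `ℤ_p[x]/(x^{p^t} − 1, (x − 1)²)` is
isomorphic, via `x ↦ 1 + X`, to `ℤ_p[X]/(X², p^t·X)`. -/
theorem span_pow_sub_one_eq_span
    (p : ℕ) [Fact p.Prime] (t : ℕ) (ht : 1 ≤ t) :
    (Ideal.span (insert ((X : Polynomial ℤ_[p]) ^ (p ^ t) - 1)
        ((fun m : ℕ => ((X : Polynomial ℤ_[p]) ^ m - 1) ^ 2) '' (Set.Icc 1 (p ^ t))))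
      = Ideal.span {((p : Polynomial ℤ_[p]) ^ t) * ((X : Polynomial ℤ_[p]) - 1),
          ((X : Polynomial ℤ_[p]) - 1) ^ 2})
    ∧ ∃ e : (Polynomial ℤ_[p] ⧸
              Ideal.span {(X : Polynomial ℤ_[p]) ^ (p ^ t) - 1,
                ((X : Polynomial ℤ_[p]) - 1) ^ 2}) ≃+*
            (Polynomial ℤ_[p] ⧸
              Ideal.span {(X : Polynomial ℤ_[p]) ^ 2,
                ((p : Polynomial ℤ_[p]) ^ t) * (X : Polynomial ℤ_[p])}),
        e (Ideal.Quotient.mk _ X) = Ideal.Quotient.mk _ (1 + X) := by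
  have hp : 1 ≤ p ^ t := Nat.one_le_pow _ _ (Fact.out : p.Prime).pos
  have key := Ideal.span_pow_sub_one_sub_one_sq (X : Polynomial ℤ_[p]) (p ^ t)
  rw [Nat.cast_pow] at key
  refine ⟨(Ideal.span_insert_pow_sub_one_sq _ _ hp).trans key, ?_⟩
  refine ⟨Ideal.quotientEquiv _ _ (algEquivAevalXAddC (1 : ℤ_[p])).toRingEquiv ?_, ?_⟩
  · rw [key, Ideal.map_span, Set.image_pair, Set.pair_comm]
    simp
  · rw [Ideal.quotientEquiv_mk]
    simp [add_comm]
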